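/- arXiv:1409.1168 — 2 statements merged into one kernel-verified Lean document; each statement's English description precedes it below -/
import Mathlib

section
/- Let z ∈ B_{α-1}. If (a_i)_{i≥2} and (b_i)_{i≥2} are admissible sequences such that z = (α - 1) + Σ_{i=2}^∞ a_i α^i and z = Σ_{i=2}^∞ b_i α^i, then a_2 = 0, b_2 = a - 1 and b_4 = 0. -/
open Complex Filter Topology

noncomputable section

/-- The word `w₁w₂w₃w₄` is lexicographically smaller than the word `(a-1)(a-1)01`. -/
def WordLt (a : ℤ) (w₁ w₂ w₃ w₄ : ℤ) : Prop :=
  w₁ < a - 1 ∨ (w₁ = a - 1 ∧ (w₂ < a - 1 ∨ (w₂ = a - 1 ∧ (w₃ < 0 ∨ (w₃ = 0 ∧ w₄ < 1)))))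

/-- A sequence of integers `(c i)_{i ≥ k}` with `0 ≤ c i ≤ a-1` is admissible if for every
`i ≥ k+3` the word `c i, c (i-1), c (i-2), c (i-3)` is lexicographically smaller
than `(a-1)(a-1)01`. (Values of `c` below index `k` are irrelevant.) -/
def Admissible (a k : ℤ) (c : ℤ → ℤ) : Prop :=
  (∀ i, k ≤ i → 0 ≤ c i ∧ c i ≤ a - 1) ∧
  (∀ i, k + 3 ≤ i → WordLt a (c i) (c (i - 1)) (c (i - 2)) (c (i - 3)))

/-- The Rauzy fractal `R_a = { Σ_{i=2}^∞ c_i α^i : (c_i)_{i≥2} admissible }`. -/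
def Rauzy (a : ℤ) (α : ℂ) : Set ℂ :=
  {z | ∃ c : ℤ → ℤ, Admissible a 2 c ∧
    z = ∑' n : ℕ, (c ((n : ℤ) + 2) : ℂ) * α ^ (n + 2)}

/-- `B_v = R_a ∩ (R_a + v)`. -/
def BSet (a : ℤ) (α : ℂ) (v : ℂ) : Set ℂ :=
  Rauzy a α ∩ ((· + v) '' Rauzy a α)

/-- `B'_{α-1}`: points of `B_{α-1}` admitting an admissible expansion
`z = α - 1 + Σ_{i=3}^∞ c_i α^i` with `c 3 ≠ a-1`. -/
def Bprime (a : ℤ) (α : ℂ) : Set ℂ :=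
  {z | z ∈ BSet a α (α - 1) ∧ ∃ c : ℤ → ℤ, Admissible a 3 c ∧ c 3 ≠ a - 1 ∧
    z = α - 1 + ∑' n : ℕ, (c ((n : ℤ) + 3) : ℂ) * α ^ (n + 3)}

/-- `g_{2k+1}(z) = -1 - k α³ + α³ z`. -/
def gOdd (α : ℂ) (k : ℤ) (z : ℂ) : ℂ := -1 - (k : ℂ) * α ^ 3 + α ^ 3 * z

/-- `g_{2k}(z) = α - 1 + (a-1-k) α³ + α² z`. -/
def gEven (a : ℤ) (α : ℂ) (k : ℤ) (z : ℂ) : ℂ :=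
  α - 1 + ((a : ℂ) - 1 - (k : ℂ)) * α ^ 3 + α ^ 2 * z

/-- The quotient sequence of the digit difference by the reciprocal polynomial. -/
def eseq (a : ℤ) (d : ℕ → ℤ) : ℕ → ℤ
  | 0 => 0
  | 1 => 0
  | 2 => 0
  | n + 3 => d n + eseq a d (n + 2) - a * eseq a d (n + 1) + eseq a d n

/-- The sequence of digit differences, starting with `1 - X`. -/
def dseq (A B : ℤ → ℤ) : ℕ → ℤ
  | 0 => 1
  | 1 => -1
  | n + 2 => B ((n : ℤ) + 2) - A ((n : ℤ) + 2)

lemma root_facts (a : ℤ) (ha : 3 ≤ a) (α : ℂ)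
    (hroot : α ^ 3 - (a : ℂ) * α ^ 2 + α - 1 = 0) (hα : α.im ≠ 0) :
    ‖α‖ < 1 ∧ (α.re ^ 2 + α.im ^ 2) * (a - 2 * α.re) = 1 ∧
      0 < α.re ^ 2 + α.im ^ 2 ∧ α.re ^ 2 + α.im ^ 2 < 1 := by
  obtain ⟨x, y⟩ := α
  simp only at hα
  have hre := congrArg Complex.re hroot
  have him := congrArg Complex.im hroot
  simp [pow_succ] at hre him
  have haR : (3 : ℝ) ≤ a := by exact_mod_cast ha
  have h1 : 3 * x ^ 2 - y ^ 2 - 2 * a * x + 1 = 0 := by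
    apply mul_left_cancel₀ hα
    linear_combination him
  have hb : (x ^ 2 + y ^ 2) * (a - 2 * x) = 1 := by
    linear_combination hre - x * h1
  have hq : 0 < x ^ 2 + y ^ 2 := by positivity
  have hlt : x ^ 2 + y ^ 2 < 1 := by
    by_contra hge
    push Not at hge
    set q := x ^ 2 + y ^ 2 with hqd
    have hs : 2 * x = q - q ^ 2 := by
      have : 4 * x ^ 2 - q - 2 * a * x + 1 = 0 := by rw [hqd]; linear_combination h1
      linear_combination -(2 * x * hb + q * this)
    nlinarith
  refine ⟨?_, hb, hq, hlt⟩
  have : ‖(⟨x, y⟩ : ℂ)‖ ^ 2 < 1 := by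
    rw [Complex.sq_norm, Complex.normSq_mk]; nlinarith
  nlinarith [norm_nonneg (⟨x, y⟩ : ℂ)]

lemma tail_bound (d : ℕ → ℤ) (C : ℝ) (hd : ∀ n, |(d n : ℝ)| ≤ C) (α : ℂ) (h1 : ‖α‖ < 1)
    (h0 : α ≠ 0) (hsum : ∑' n, (d n : ℂ) * α ^ n = 0) (T : ℕ → ℂ)
    (hT0 : T 0 = 0) (hT : ∀ n, T n = d n + α * T (n + 1)) :
    ∀ n, ‖T n‖ ≤ C * (1 - ‖α‖)⁻¹ := by
  have hb : ∀ n k, ‖(d (k + n) : ℂ) * α ^ k‖ ≤ C * ‖α‖ ^ k := by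
    intro n k
    rw [norm_mul, norm_pow]
    have := hd (k + n)
    rw [Complex.norm_intCast]
    gcongr
  have hg := (hasSum_geometric_of_lt_one (norm_nonneg α) h1).mul_left C
  have hs : Summable fun k => (d k : ℂ) * α ^ k :=
    Summable.of_norm_bounded hg.summable (fun k => hb 0 k)
  intro n
  have hpart : ∀ n, ∑ i ∈ Finset.range n, (d i : ℂ) * α ^ i + α ^ n * T n = 0 := by
    intro n
    induction n with
    | zero => simp [hT0]
    | succ n ih =>
      rw [Finset.sum_range_succ]
      rw [hT n] at ih
      linear_combination ih
  have h2 := hs.sum_add_tsum_nat_add n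
  rw [hsum] at h2
  have h3 : T n = ∑' k, (d (k + n) : ℂ) * α ^ k := by
    apply mul_left_cancel₀ (pow_ne_zero n h0)
    rw [← tsum_mul_left]
    have : ∀ k, α ^ n * ((d (k + n) : ℂ) * α ^ k) = (d (k + n) : ℂ) * α ^ (k + n) := by
      intro k; ring
    simp_rw [this]
    linear_combination hpart n - h2
  rw [h3]
  exact tsum_of_norm_bounded hg (hb n)

lemma e_bounded (a : ℤ) (ha : 3 ≤ a) (α : ℂ)
    (hroot : α ^ 3 - (a : ℂ) * α ^ 2 + α - 1 = 0) (hα : α.im ≠ 0)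
    (d : ℕ → ℤ) (hd : ∀ n, |d n| ≤ a - 1) (hsum : ∑' n, (d n : ℂ) * α ^ n = 0) :
    ∃ M : ℕ, ∀ n, |eseq a d n| ≤ M := by
  obtain ⟨h1, hq1, hq0, hq⟩ := root_facts a ha α hroot hα
  have h0 : α ≠ 0 := by rintro rfl; simp at hα
  have hT := tail_bound d (a - 1) (fun n => by exact_mod_cast hd n) α h1 h0 hsum
    (fun n => -(eseq a d n : ℂ) + (a - α) * eseq a d (n + 1)
      + (a * α - α ^ 2 - 1) * eseq a d (n + 2)) (by simp [eseq]) (by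
      intro n
      have : eseq a d (n + 1 + 2) = d n + eseq a d (n + 2) - a * eseq a d (n + 1) + eseq a d n := by
        simp [eseq]
      simp only [this]
      push_cast
      have e2 : n + 1 + 1 = n + 2 := rfl
      rw [e2]
      linear_combination ((d n : ℂ) + eseq a d (n + 2) - a * eseq a d (n + 1) + eseq a d n) * hroot)
  set q := α.re ^ 2 + α.im ^ 2 with hqd
  set C := ((a : ℝ) - 1) * (1 - ‖α‖)⁻¹
  set K := C / |α.im| with hK
  have hy : 0 < |α.im| := abs_pos.mpr hα
  have hC : 0 ≤ C := (norm_nonneg _).trans (hT 0)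
  have hK0 : 0 ≤ K := by positivity
  have hrec : ∀ n, |(a - 2 * α.re) * (eseq a d (n + 2) : ℝ) - eseq a d (n + 1)| ≤ K := by
    intro n
    rw [hK, le_div_iff₀ hy, ← abs_mul]
    refine le_trans (le_of_eq ?_) ((Complex.abs_im_le_norm _).trans (hT n))
    congr 1
    simp [pow_two]
    ring
  have hbound : ∀ n, |(eseq a d n : ℝ)| ≤ K * q / (1 - q) := by
    have hpos : 0 ≤ K * q / (1 - q) := by
      apply div_nonneg (by positivity); linarith
    intro n
    induction n with
    | zero => simpa [eseq] using hpos
    | succ n ih =>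
      cases n with
      | zero => simpa [eseq] using hpos
      | succ n =>
        have h := hrec n
        have heq : (eseq a d (n + 2) : ℝ) = q * ((a - 2 * α.re) * (eseq a d (n + 2) : ℝ)
            - eseq a d (n + 1)) + q * eseq a d (n + 1) := by
          linear_combination -(eseq a d (n + 2) : ℝ) * hq1
        have : |(eseq a d (n + 2) : ℝ)| ≤ q * K + q * (K * q / (1 - q)) := by
          rw [heq]
          refine (abs_add_le _ _).trans ?_
          rw [abs_mul, abs_mul, abs_of_pos hq0]
          gcongr
        refine this.trans (le_of_eq ?_)
        have : 1 - q ≠ 0 := by linarith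
        field_simp
        ring
  obtain ⟨M, hM⟩ := exists_nat_ge (K * q / (1 - q))
  refine ⟨M, fun n => ?_⟩
  exact_mod_cast (hbound n).trans hM

/-- The local constraints. -/
def Loc (e : ℕ → ℤ) : Prop := ∀ n, (1 ≤ e (n + 1) → 3 * e (n + 1) - 2 ≤ e (n + 2) + e n - e (n + 3)) ∧
  (e (n + 1) ≤ -1 → e (n + 2) + e n - e (n + 3) ≤ 3 * e (n + 1) + 2)

lemma loc_neg {e : ℕ → ℤ} (h : Loc e) : Loc (fun n => - e n) := by
  intro n
  have := h n
  dsimp only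
  constructor <;> intro <;> omega

lemma no_max_big (e : ℕ → ℤ) (h : Loc e) (M : ℤ) (hM : 3 ≤ M) (hb : ∀ n, -M ≤ e n ∧ e n ≤ M)
    (n : ℕ) : e (n + 1) ≠ M := by
  intro hn
  obtain ⟨a0, b0⟩ := h n
  obtain ⟨a1, b1⟩ := h (n + 1)
  obtain ⟨a2, b2⟩ := h (n + 2)
  obtain ⟨a3, b3⟩ := h (n + 3)
  have c0 := hb n
  have c2 := hb (n + 2)
  have c3 := hb (n + 3)
  have c4 := hb (n + 4)
  have c5 := hb (n + 5)
  have c6 := hb (n + 6)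
  simp only [add_assoc, Nat.reduceAdd] at *
  omega

lemma no_max_two (e : ℕ → ℤ) (h : Loc e) (hb : ∀ n, -2 ≤ e n ∧ e n ≤ 2)
    (n : ℕ) (hn : e (n + 1) = 2) : e n = 2 ∧ e (n + 2) = 1 := by
  obtain ⟨a0, b0⟩ := h n
  obtain ⟨a1, b1⟩ := h (n + 1)
  obtain ⟨a2, b2⟩ := h (n + 2)
  obtain ⟨a3, b3⟩ := h (n + 3)
  obtain ⟨a4, b4⟩ := h (n + 4)
  obtain ⟨a5, b5⟩ := h (n + 5)
  have c0 := hb n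
  have c2 := hb (n + 2)
  have c3 := hb (n + 3)
  have c4 := hb (n + 4)
  have c5 := hb (n + 5)
  have c6 := hb (n + 6)
  have c7 := hb (n + 7)
  have c8 := hb (n + 8)
  simp only [add_assoc, Nat.reduceAdd] at *
  have a0' := a0 (by omega)
  have h2 : e (n + 2) = 0 ∨ e (n + 2) = 1 ∨ e (n + 2) = 2 := by omega
  have h3 : e (n + 3) = -2 ∨ e (n + 3) = -1 ∨ e (n + 3) = 0 := by omega
  have h0 : e n = 0 ∨ e n = 1 ∨ e n = 2 := by omega
  clear a0 b0
  rcases h2 with h2 | h2 | h2 <;> rcases h3 with h3 | h3 | h3 <;>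
    rcases h0 with h0 | h0 | h0 <;> simp only [h0, h2, h3, hn] at * <;> norm_num at * <;> omega

lemma no_max (e : ℕ → ℤ) (h : Loc e) (h0 : e 0 = 0) (M : ℤ) (hM : 2 ≤ M)
    (hb : ∀ n, -M ≤ e n ∧ e n ≤ M) (n : ℕ) : e n ≠ M := by
  rcases n with _ | n
  · rw [h0]; omega
  rcases hM.lt_or_eq with hM | rfl
  · exact no_max_big e h M (by omega) hb n
  · intro hn
    obtain ⟨h1, h2⟩ := no_max_two e h hb n hn
    rcases n with _ | n
    · rw [h0] at h1; norm_num at h1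
    · have h3 := (no_max_two e h hb n h1).2
      have h4 : e (n + 2) = 2 := hn
      rw [h3] at h4; norm_num at h4

lemma descend (e : ℕ → ℤ) (h : Loc e) (h0 : e 0 = 0) (M : ℕ)
    (hb : ∀ n, |e n| ≤ M) : ∀ n, |e n| ≤ 1 := by
  induction M with
  | zero => intro n; have := hb n; push_cast at this; omega
  | succ M ih =>
    rcases Nat.eq_zero_or_pos M with rfl | hM
    · simpa using hb
    · apply ih
      have hb' : ∀ n, -((M : ℤ) + 1) ≤ e n ∧ e n ≤ M + 1 := by
        intro n; have := hb n; rw [abs_le] at this; push_cast at this; exact this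
      intro n
      have h1 := no_max e h h0 (M + 1) (by omega) hb' n
      have h2 := no_max (fun n => - e n) (loc_neg h) (by simp [h0]) (M + 1) (by omega)
        (fun n => by have := hb' n; omega) n
      have := hb' n
      rw [abs_le]
      omega

lemma eseq_loc (a : ℤ) (ha : 3 ≤ a) (d : ℕ → ℤ) (hd : ∀ n, |d n| ≤ a - 1) :
    Loc (eseq a d) := by
  intro n
  have h : eseq a d (n + 3) = d n + eseq a d (n + 2) - a * eseq a d (n + 1) + eseq a d n := by
    rw [eseq]
  have := abs_le.mp (hd n)
  constructor <;> intro h1 <;> nlinarith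

lemma dseq_sum (a : ℤ) (α : ℂ) (h1 : ‖α‖ < 1) (A B : ℤ → ℤ)
    (hA : Admissible a 2 A) (hB : Admissible a 2 B)
    (h : (α - 1) + ∑' n : ℕ, (A ((n : ℤ) + 2) : ℂ) * α ^ (n + 2)
      = ∑' n : ℕ, (B ((n : ℤ) + 2) : ℂ) * α ^ (n + 2)) :
    ∑' n, (dseq A B n : ℂ) * α ^ n = 0 := by
  have hs : ∀ c : ℤ → ℤ, Admissible a 2 c →
      Summable fun n : ℕ => (c ((n : ℤ) + 2) : ℂ) * α ^ (n + 2) := by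
    intro c hc
    have hg := (hasSum_geometric_of_lt_one (norm_nonneg α) h1).mul_left ((a : ℝ) * ‖α‖ ^ 2)
    refine Summable.of_norm_bounded hg.summable (fun n => ?_)
    obtain ⟨c1, c2⟩ := hc.1 (n + 2) (by omega)
    have : |(c ((n : ℤ) + 2) : ℝ)| ≤ a := by
      have : |c ((n : ℤ) + 2)| ≤ a := by rw [abs_le]; omega
      exact_mod_cast this
    rw [norm_mul, norm_pow, Complex.norm_intCast, mul_assoc, ← pow_add, add_comm 2 n]
    gcongr
  have hd : (fun n : ℕ => (dseq A B (n + 2) : ℂ) * α ^ (n + 2)) = fun n : ℕ =>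
      (B ((n : ℤ) + 2) : ℂ) * α ^ (n + 2) - (A ((n : ℤ) + 2) : ℂ) * α ^ (n + 2) := by
    funext n
    simp only [dseq]
    push_cast
    ring
  have hsd := (hs B hB).sub (hs A hA)
  rw [← hd] at hsd
  have hsd' : Summable fun n : ℕ => (dseq A B n : ℂ) * α ^ n :=
    (summable_nat_add_iff (f := fun n : ℕ => (dseq A B n : ℂ) * α ^ n) 2).mp hsd
  rw [← hsd'.sum_add_tsum_nat_add 2, hd, (hs B hB).tsum_sub (hs A hA), ← h]
  simp [Finset.sum_range_succ, dseq]
  ring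

theorem bset_digits (a : ℤ) (ha : 3 ≤ a) (α : ℂ)
    (hroot : α ^ 3 - (a : ℂ) * α ^ 2 + α - 1 = 0) (hα : α.im ≠ 0)
    (z : ℂ) (hz : z ∈ BSet a α (α - 1))
    (A B : ℤ → ℤ) (hA : Admissible a 2 A) (hB : Admissible a 2 B)
    (hzA : z = (α - 1) + ∑' n : ℕ, (A ((n : ℤ) + 2) : ℂ) * α ^ (n + 2))
    (hzB : z = ∑' n : ℕ, (B ((n : ℤ) + 2) : ℂ) * α ^ (n + 2)) :
    A 2 = 0 ∧ B 2 = a - 1 ∧ B 4 = 0 := by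
  obtain ⟨h1, -, -, -⟩ := root_facts a ha α hroot hα
  have hsum := dseq_sum a α h1 A B hA hB (hzA.symm.trans hzB)
  have hd : ∀ n, |dseq A B n| ≤ a - 1 := by
    intro n
    rw [abs_le]
    match n with
    | 0 => simp only [dseq]; omega
    | 1 => simp only [dseq]; omega
    | n + 2 =>
      have := hA.1 (n + 2) (by omega)
      have := hB.1 (n + 2) (by omega)
      simp only [dseq]
      omega
  obtain ⟨M, hM⟩ := e_bounded a ha α hroot hα _ hd hsum
  have hb := descend _ (eseq_loc a ha _ hd) (by simp [eseq]) M hM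
  have r3 : eseq a (dseq A B) 3 = 1 := by simp [eseq, dseq]
  have r4 : eseq a (dseq A B) 4 = 0 := by simp [eseq, dseq]
  have r5 : eseq a (dseq A B) 5 = (B 2 - A 2) + eseq a (dseq A B) 4
      - a * eseq a (dseq A B) 3 + eseq a (dseq A B) 2 := rfl
  have r2 : eseq a (dseq A B) 2 = 0 := by simp [eseq]
  have r6 : eseq a (dseq A B) 6 = (B 3 - A 3) + eseq a (dseq A B) 5
      - a * eseq a (dseq A B) 4 + eseq a (dseq A B) 3 := by rw [eseq]; simp [dseq]
  have r7 : eseq a (dseq A B) 7 = (B 4 - A 4) + eseq a (dseq A B) 6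
      - a * eseq a (dseq A B) 5 + eseq a (dseq A B) 4 := by rw [eseq]; simp [dseq]
  have r8 : eseq a (dseq A B) 8 = (B 5 - A 5) + eseq a (dseq A B) 7
      - a * eseq a (dseq A B) 6 + eseq a (dseq A B) 5 := by rw [eseq]; simp [dseq]
  have b5 := abs_le.mp (hb 5)
  have b6 := abs_le.mp (hb 6)
  have b7 := abs_le.mp (hb 7)
  have b8 := abs_le.mp (hb 8)
  have A2 := hA.1 2 (by norm_num)
  have A3 := hA.1 3 (by norm_num)
  have A4 := hA.1 4 (by norm_num)
  have A5 := hA.1 5 (by norm_num)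
  have B2 := hB.1 2 (by norm_num)
  have B3 := hB.1 3 (by norm_num)
  have B4 := hB.1 4 (by norm_num)
  have B5 := hB.1 5 (by norm_num)
  have wA := hA.2 5 (by norm_num)
  norm_num [WordLt] at wA
  generalize eseq a (dseq A B) 2 = e2 at *
  generalize eseq a (dseq A B) 3 = e3 at *
  generalize eseq a (dseq A B) 4 = e4 at *
  generalize eseq a (dseq A B) 5 = e5 at *
  generalize eseq a (dseq A B) 6 = e6 at *
  generalize eseq a (dseq A B) 7 = e7 at *
  generalize eseq a (dseq A B) 8 = e8 at *
  subst r3 r4 r2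
  have h5 : e5 = -1 := by omega
  subst h5
  have h6 : e6 = -1 ∨ e6 = 0 ∨ e6 = 1 := by omega
  rcases h6 with rfl | rfl | rfl <;> refine ⟨by omega, by omega, by omega⟩
end
end

section
/- The intersections B_{α-1} ∩ B_{1-α} and B_{α²-α} ∩ B_{α-α²} are both empty. -/
open Complex Filter Topology

noncomputable section

/-- Integer boundedness lemma, case `a ≥ 4`. -/
lemma aux_bound4 (a : ℤ) (ha : 4 ≤ a) (M : ℤ) (r : ℕ → ℤ)
    (hb : ∀ n, -M ≤ r n ∧ r n ≤ M)
    (hc : ∀ n, -(a - 1) ≤ r (n+2) + r n - a * r (n+1) - r (n+3) ∧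
      r (n+2) + r n - a * r (n+1) - r (n+3) ≤ a - 1)
    (k : ℕ) (hk : |r (k+1)| = M) : M ≤ 3 := by
  by_contra! h
  have c := hc k
  have h0 := hb k
  have h2 := hb (k+2)
  have h3 := hb (k+3)
  rcases abs_cases (r (k+1)) with ⟨h1, _⟩ | ⟨h1, _⟩
  · have e : r (k+1) = M := by omega
    rw [e] at c
    nlinarith
  · have e : r (k+1) = -M := by omega
    rw [e] at c
    nlinarith

lemma aux_bound3 (M : ℤ) (r : ℕ → ℤ)
    (hb : ∀ n, -M ≤ r n ∧ r n ≤ M)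
    (hc : ∀ n, -2 ≤ r (n+2) + r n - 3 * r (n+1) - r (n+3) ∧
      r (n+2) + r n - 3 * r (n+1) - r (n+3) ≤ 2)
    (k : ℕ) (hk : |r (k+1)| = M) : M ≤ 2 := by
  by_contra! h
  obtain ⟨h0, h0'⟩ := hb k
  obtain ⟨h2, h2'⟩ := hb (k+2)
  obtain ⟨h3, h3'⟩ := hb (k+3)
  obtain ⟨h4, h4'⟩ := hb (k+4)
  obtain ⟨h5, h5'⟩ := hb (k+5)
  obtain ⟨h6, h6'⟩ := hb (k+6)
  obtain ⟨h7, h7'⟩ := hb (k+7)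
  obtain ⟨h8, h8'⟩ := hb (k+8)
  obtain ⟨c0, c0'⟩ := hc k
  obtain ⟨c1, c1'⟩ := hc (k+1)
  obtain ⟨c2, c2'⟩ := hc (k+2)
  obtain ⟨c3, c3'⟩ := hc (k+3)
  obtain ⟨c4, c4'⟩ := hc (k+4)
  obtain ⟨c5, c5'⟩ := hc (k+5)
  simp only [add_assoc, Nat.reduceAdd] at *
  generalize r k = x0 at *
  generalize r (k+1) = x1 at *
  generalize r (k+2) = x2 at *
  generalize r (k+3) = x3 at *
  generalize r (k+4) = x4 at *
  generalize r (k+5) = x5 at *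
  generalize r (k+6) = x6 at *
  generalize r (k+7) = x7 at *
  generalize r (k+8) = x8 at *
  clear hb hc
  rcases abs_cases x1 with ⟨h1, _⟩ | ⟨h1, _⟩
  · have e : x1 = M := by omega
    subst e
    linarith
  · have e : M = -x1 := by omega
    subst e
    linarith

lemma aux_max (r : ℕ → ℤ) (B : ℤ) (hB : ∀ n, |r n| ≤ B) : ∃ k, ∀ n, |r n| ≤ |r k| := by
  have hf : (Set.range (fun n => |r n|)).Finite :=
    (Set.finite_Icc (0:ℤ) B).subset (by rintro _ ⟨n, rfl⟩; exact ⟨abs_nonneg _, hB n⟩)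
  obtain ⟨m, ⟨k, rfl⟩, hm⟩ := Set.exists_max_image _ id hf (Set.range_nonempty _)
  exact ⟨k, fun n => hm _ ⟨n, rfl⟩⟩

lemma aux_bound (a : ℤ) (ha : 3 ≤ a) (r : ℕ → ℤ) (B : ℤ) (hB : ∀ n, |r n| ≤ B)
    (h0 : |r 0| ≤ 2)
    (hc : ∀ n, -(a - 1) ≤ r (n+2) + r n - a * r (n+1) - r (n+3) ∧
      r (n+2) + r n - a * r (n+1) - r (n+3) ≤ a - 1) :
    (a = 3 ∧ ∀ n, |r n| ≤ 2) ∨ (4 ≤ a ∧ ∀ n, |r n| ≤ 3) := by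
  obtain ⟨k, hk⟩ := aux_max r B hB
  have hb : ∀ n, -|r k| ≤ r n ∧ r n ≤ |r k| := fun n => abs_le.mp (hk n)
  rcases eq_or_lt_of_le ha with h | h
  · left
    refine ⟨h.symm, fun n => (hk n).trans ?_⟩
    subst h
    rcases k with _ | k
    · exact h0
    · exact aux_bound3 _ r hb (by simpa using hc) k rfl
  · right
    refine ⟨h, fun n => (hk n).trans ?_⟩
    rcases k with _ | k
    · omega
    · exact aux_bound4 a h _ r hb hc k rfl

/-- Basic facts about the root. -/
lemma aux_root (a : ℤ) (ha : 3 ≤ a) (α : ℂ)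
    (hroot : α ^ 3 - (a : ℂ) * α ^ 2 + α - 1 = 0) (hα : α.im ≠ 0) :
    1 < (a : ℝ) - 2 * α.re ∧ ‖α‖ < 1 := by
  have hre := congrArg Complex.re hroot
  have him := congrArg Complex.im hroot
  simp [pow_succ] at hre him
  set x := α.re with hx
  set y := α.im with hy
  have haR : (3:ℝ) ≤ a := by exact_mod_cast ha
  have hy2 : y^2 = 3*x^2 - 2*a*x + 1 := by
    apply mul_left_cancel₀ hα
    linear_combination -him
  set b := (a:ℝ) - 2*x with hb
  have hp : b^3 - a*b^2 + b - 1 = 0 := by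
    rw [hb]
    linear_combination hre + (3*x - a) * hy2
  have hb1 : 1 < b := by
    by_contra! hle
    rcases eq_or_ne b 0 with h0 | h0
    · rw [h0] at hp; norm_num at hp
    · have : 0 < b^2 := by positivity
      nlinarith
  have hn : (x^2+y^2) * b = 1 := by
    rw [hy2]
    have : x = (a - b)/2 := by rw [hb]; ring
    rw [this]
    linear_combination hp
  refine ⟨hb1, ?_⟩
  have hns : ‖α‖^2 = x^2+y^2 := by
    rw [← Complex.normSq_eq_norm_sq, Complex.normSq_apply]; ring
  have : ‖α‖^2 < 1 := by
    rw [hns]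
    by_contra! h
    nlinarith
  have h0 := norm_nonneg α
  nlinarith

/-- state sequence -/
def auxState (a : ℤ) (d : ℕ → ℤ) (s : ℤ × ℤ × ℤ) : ℕ → ℤ × ℤ × ℤ
  | 0 => s
  | n+1 =>
    let t := auxState a d s n
    (t.1 - d n + t.2.1, t.2.2 - a * (t.1 - d n), t.1 - d n)

lemma aux_main (a : ℤ) (ha : 3 ≤ a) (α : ℂ)
    (hroot : α ^ 3 - (a : ℂ) * α ^ 2 + α - 1 = 0) (hα : α.im ≠ 0)
    (d : ℕ → ℤ) (hd : ∀ n, |d n| ≤ a - 1) (p q r0 : ℤ)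
    (hT : ∑' n, (d n : ℂ) * α ^ n = p + q * α + r0 * α ^ 2) (hr0 : |r0| ≤ 2) :
    ∃ r : ℕ → ℤ, r 0 = r0 ∧ d 0 = p - r 1 ∧ d 1 = r 1 + q - r 2 ∧
      d 2 = r 2 + r 0 - a * r 1 - r 3 ∧
      ((a = 3 ∧ ∀ n, |r n| ≤ 2) ∨ (4 ≤ a ∧ ∀ n, |r n| ≤ 3)) := by
  obtain ⟨hb, hn⟩ := aux_root a ha α hroot hα
  have haR : (3:ℝ) ≤ a := by exact_mod_cast ha
  have hα0 : α ≠ 0 := by rintro rfl; simp at hα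
  have hdR : ∀ n, ‖(d n : ℂ)‖ ≤ (a:ℝ) - 1 := by
    intro n
    rw [Complex.norm_intCast]
    exact_mod_cast hd n
  have hgs : HasSum (fun k => ((a:ℝ) - 1) * ‖α‖ ^ k) (((a:ℝ) - 1) * (1 - ‖α‖)⁻¹) :=
    (hasSum_geometric_of_lt_one (norm_nonneg _) hn).mul_left _
  have hle : ∀ n k, ‖(d (n + k) : ℂ) * α ^ k‖ ≤ ((a:ℝ) - 1) * ‖α‖ ^ k := by
    intro n k
    rw [norm_mul, norm_pow]
    exact mul_le_mul_of_nonneg_right (hdR _) (by positivity)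
  have hsum : ∀ n, Summable (fun k => (d (n + k) : ℂ) * α ^ k) := fun n =>
    Summable.of_norm_bounded hgs.summable (hle n)
  set C := ((a:ℝ) - 1) * (1 - ‖α‖)⁻¹ with hC
  have hbd : ∀ n, ‖∑' k, (d (n + k) : ℂ) * α ^ k‖ ≤ C := fun n =>
    tsum_of_norm_bounded hgs (hle n)
  have hstep : ∀ n, ∑' k, (d (n + k) : ℂ) * α ^ k
      = d n + α * ∑' k, (d (n + 1 + k) : ℂ) * α ^ k := by
    intro n
    rw [(hsum n).tsum_eq_zero_add, ← tsum_mul_left]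
    simp only [pow_zero, mul_one, add_zero]
    congr 1
    apply tsum_congr
    intro k
    rw [show n + (k + 1) = n + 1 + k by ring]
    ring
  let S := auxState a d (p, q, r0)
  have hS : ∀ n, S (n+1) = ((S n).1 - d n + (S n).2.1, (S n).2.2 - a * ((S n).1 - d n),
      (S n).1 - d n) := fun n => rfl
  have hinv : ∀ n, ∑' k, (d (n + k) : ℂ) * α ^ k
      = (S n).1 + (S n).2.1 * α + (S n).2.2 * α ^ 2 := by
    intro n
    induction n with
    | zero => simpa [S, auxState] using hT
    | succ n ih =>
      rw [hstep n] at ih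
      apply mul_left_cancel₀ hα0
      rw [hS]
      push_cast
      linear_combination ih - ((S n).1 - d n : ℂ) * hroot
  have hP : ∀ n, (S (n+1)).1 = (S (n+1)).2.2 + (S n).2.1 := fun n => by simp [hS]
  have hQ : ∀ n, (S (n+1)).2.1 = (S n).2.2 - a * (S (n+1)).2.2 := fun n => by simp [hS]
  have hR : ∀ n, d n = (S n).1 - (S (n+1)).2.2 := fun n => by simp [hS]
  have hdr : ∀ n, d (n+2) = (S (n+2)).2.2 + (S n).2.2 - a * (S (n+1)).2.2 - (S (n+3)).2.2 := by
    intro n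
    have h1 := hR (n+2)
    have h2 := hP (n+1)
    have h3 := hQ n
    linarith
  -- boundedness
  have hbound : ∃ B : ℤ, ∀ n, |(S n).2.2| ≤ B := by
    set y := α.im with hy
    set b := (a:ℝ) - 2 * α.re with hbdef
    have hy0 : 0 < |y| := abs_pos.mpr hα
    have key : ∀ n, |((S n).2.2 : ℝ) - b * (S (n+1)).2.2| ≤ C / |y| := by
      intro n
      rw [le_div_iff₀ hy0, ← abs_mul]
      have h1 := (Complex.abs_im_le_norm _).trans (hbd (n+1))
      rw [hinv (n+1)] at h1
      refine le_of_eq_of_le (congrArg abs ?_) h1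
      rw [hQ]
      simp [pow_two]
      rw [hbdef, hy]
      ring
    have hC0 : 0 ≤ C / |y| := le_trans (abs_nonneg _) (key 0)
    set K := max 2 (C / |y| / (b - 1)) with hK
    have hK1 : C / |y| ≤ K * (b - 1) := by
      rw [← div_le_iff₀ (by linarith)]; exact le_max_right _ _
    have hall : ∀ n, |((S n).2.2 : ℝ)| ≤ K := by
      intro n
      induction n with
      | zero =>
        refine le_trans ?_ (le_max_left _ _)
        have : S 0 = (p, q, r0) := rfl
        rw [this]
        exact_mod_cast hr0
      | succ n ih =>
        have h1 := key n
        rw [abs_le] at h1 ih ⊢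
        constructor <;> by_contra! h <;> nlinarith
    obtain ⟨B, hB⟩ := exists_int_gt K
    refine ⟨B, fun n => ?_⟩
    have := (hall n).trans hB.le
    exact_mod_cast this
  obtain ⟨B, hB⟩ := hbound
  refine ⟨fun n => (S n).2.2, rfl, hR 0, ?_, hdr 0, ?_⟩
  · have h1 := hR 1
    have h2 := hP 0
    have h3 : (S 0).2.1 = q := rfl
    simp only [zero_add] at *
    linarith
  · refine aux_bound a ha _ B hB hr0 fun n => ?_
    have := hd (n+2)
    rw [hdr n, abs_le] at this
    exact this

/-- Two points of the fractal whose difference is given produce a bounded digit sequence. -/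
lemma aux_diff (a : ℤ) (ha : 3 ≤ a) (α : ℂ)
    (hroot : α ^ 3 - (a : ℂ) * α ^ 2 + α - 1 = 0) (hα : α.im ≠ 0)
    (x y w : ℂ) (hx : x ∈ Rauzy a α) (hy : y ∈ Rauzy a α) (h : y - x = α ^ 2 * w) :
    ∃ d : ℕ → ℤ, (∀ n, |d n| ≤ a - 1) ∧ ∑' n, (d n : ℂ) * α ^ n = w := by
  obtain ⟨hb, hn⟩ := aux_root a ha α hroot hα
  have hα0 : α ≠ 0 := by rintro rfl; simp at hα
  obtain ⟨c, hc, rfl⟩ := hx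
  obtain ⟨e, he, rfl⟩ := hy
  have hs : ∀ c : ℤ → ℤ, Admissible a 2 c →
      Summable (fun n : ℕ => (c ((n : ℤ) + 2) : ℂ) * α ^ (n + 2)) := by
    intro c hc
    refine Summable.of_norm_bounded (g := fun n => (a:ℝ) * ‖α‖ ^ 2 * ‖α‖ ^ n)
      ((summable_geometric_of_lt_one (norm_nonneg _) hn).mul_left _) fun n => ?_
    rw [norm_mul, norm_pow, Complex.norm_intCast, pow_add]
    have h1 := hc.1 ((n:ℤ) + 2) (by omega)
    have h2 : |((c ((n:ℤ)+2) : ℤ) : ℝ)| ≤ a := by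
      have : |c ((n:ℤ)+2)| ≤ a := by rw [abs_le]; constructor <;> omega
      exact_mod_cast this
    calc _ ≤ (a:ℝ) * (‖α‖ ^ n * ‖α‖ ^ 2) := mul_le_mul_of_nonneg_right h2 (by positivity)
      _ = _ := by ring
  refine ⟨fun n => e ((n:ℤ)+2) - c ((n:ℤ)+2), fun n => ?_, ?_⟩
  · have h1 := hc.1 ((n:ℤ) + 2) (by omega)
    have h2 := he.1 ((n:ℤ) + 2) (by omega)
    show |e ((n:ℤ)+2) - c ((n:ℤ)+2)| ≤ a - 1
    rw [abs_le]; constructor <;> omega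
  · apply mul_left_cancel₀ (pow_ne_zero 2 hα0)
    rw [← h, ← (hs e he).tsum_sub (hs c hc), ← tsum_mul_left]
    apply tsum_congr
    intro n
    push_cast
    ring

theorem bset_inter_empty (a : ℤ) (ha : 3 ≤ a) (α : ℂ)
    (hroot : α ^ 3 - (a : ℂ) * α ^ 2 + α - 1 = 0) (hα : α.im ≠ 0) :
    BSet a α (α - 1) ∩ BSet a α (1 - α) = ∅ ∧
    BSet a α (α ^ 2 - α) ∩ BSet a α (α - α ^ 2) = ∅ := by
  constructor
  · rw [Set.eq_empty_iff_forall_notMem]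
    rintro z ⟨⟨_, x, hx, hxz⟩, ⟨_, y, hy, hyz⟩⟩
    simp only at hxz hyz
    obtain ⟨d, hd, hT⟩ := aux_diff a ha α hroot hα x y (2 * a - 2 * α) hx hy
      (by linear_combination hyz - hxz + 2 * hroot)
    obtain ⟨r, h0, h1, -, -, hr⟩ := aux_main a ha α hroot hα d hd (2 * a) (-2) 0
      (by rw [hT]; push_cast; ring) (by norm_num)
    have hd0 := abs_le.mp (hd 0)
    rcases hr with ⟨h3, hr⟩ | ⟨h4, hr⟩
    · have := abs_le.mp (hr 1)
      omega
    · have := abs_le.mp (hr 1)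
      omega
  · rw [Set.eq_empty_iff_forall_notMem]
    rintro z ⟨⟨_, x, hx, hxz⟩, ⟨_, y, hy, hyz⟩⟩
    simp only at hxz hyz
    obtain ⟨d, hd, hT⟩ := aux_diff a ha α hroot hα x y (2 * a * α - 2 * α ^ 2) hx hy
      (by linear_combination hyz - hxz + 2 * α * hroot)
    obtain ⟨r, h0, h1, h2, h3, hr⟩ := aux_main a ha α hroot hα d hd 0 (2 * a) (-2)
      (by rw [hT]; push_cast; ring) (by norm_num)
    have hd0 := abs_le.mp (hd 0)
    have hd1 := abs_le.mp (hd 1)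
    have hd2 := abs_le.mp (hd 2)
    rcases hr with ⟨rfl, hr⟩ | ⟨h4, hr⟩
    · have k1 := abs_le.mp (hr 1)
      have k2 := abs_le.mp (hr 2)
      have k3 := abs_le.mp (hr 3)
      omega
    · have k1 := abs_le.mp (hr 1)
      have k2 := abs_le.mp (hr 2)
      have k3 := abs_le.mp (hr 3)
      have : r 1 ≤ 2 - a := by omega
      nlinarith
end
end
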